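/- Let m > 0 and r > 0 be real numbers. The pushforward of the Gamma measure gammaMeasure m r under the map Real.sqrt equals the measure on ℝ with density x ↦ 2·r^m/Γ(m)·x^{2m−1}·exp(−r·x²) for x > 0 (and 0 otherwise) with respect to Lebesgue measure; i.e., Measure.map Real.sqrt (gammaMeasure m r) = volume.withDensity (fun x => ENNReal.ofReal (if 0 < x then 2·r^m/Real.Gamma m·x^(2m−1)·Real.exp (−r·x²) else 0)). Equivalently, the square root of a Gamma(m, rate r) random variable follows the Nakagami distribution with shape m and spread ω = m/r. -/

import Mathlib

open MeasureTheory ProbabilityTheory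

/-- Restricting a lower integral to the positive half-line does not change it when the integrand
vanishes on the negative half-line. -/
lemma setLIntegral_inter_Ioi_zero {f : ℝ → ENNReal} (hf : ∀ x < 0, f x = 0) (s : Set ℝ) :
    ∫⁻ x in s ∩ Set.Ioi 0, f x = ∫⁻ x in s, f x := by
  rw [Set.inter_comm, ← setLIntegral_indicator measurableSet_Ioi]
  refine lintegral_congr_ae (ae_restrict_of_ae ?_)
  filter_upwards [Measure.ae_ne volume (0 : ℝ)] with x hx
  rcases hx.lt_or_gt with h | h
  · simp [h.not_gt, hf x h]
  · simp [h]

lemma image_sq_inter_Ioi_zero (s : Set ℝ) :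
    (fun x : ℝ => x ^ 2) '' (s ∩ Set.Ioi 0) = Real.sqrt ⁻¹' s ∩ Set.Ioi 0 := by
  ext y
  constructor
  · rintro ⟨x, ⟨hxs, hx : 0 < x⟩, rfl⟩
    exact ⟨by simpa [Real.sqrt_sq hx.le] using hxs, pow_pos hx 2⟩
  · rintro ⟨hys, hy : 0 < y⟩
    exact ⟨√y, ⟨hys, Real.sqrt_pos.2 hy⟩, Real.sq_sqrt hy.le⟩

/-- The change of variables `x ↦ x ^ 2` turns the Gamma density into the Nakagami density. -/
lemma ofReal_abs_mul_gammaPDF_sq (m r : ℝ) {x : ℝ} (hx : 0 < x) :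
    ENNReal.ofReal |2 * x| * gammaPDF m r (x ^ 2) =
      ENNReal.ofReal
        (2 * r ^ m / Real.Gamma m * x ^ (2 * m - 1) * Real.exp (-r * x ^ 2)) := by
  have hpow : x * (x ^ 2) ^ (m - 1) = x ^ (2 * m - 1) := by
    rw [← Real.rpow_natCast_mul hx.le, mul_comm, ← Real.rpow_add_one hx.ne']
    congr 1
    push_cast
    ring
  rw [gammaPDF_of_nonneg (sq_nonneg x), ← ENNReal.ofReal_mul (abs_nonneg _),
    abs_of_pos (by positivity), ← hpow]
  congr 1
  rw [neg_mul]
  ring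

/-- Final step of Theorem 2 of the paper: the square root of a `Gamma(m, rate r)` random
variable follows the Nakagami distribution with shape `m` and spread `ω = m/r`, i.e. the
pushforward of `gammaMeasure m r` under `Real.sqrt` has density
`x ↦ 2·r^m/Γ(m)·x^(2m−1)·exp(−r·x²)` on `(0, ∞)` with respect to Lebesgue measure. -/
theorem sqrt_gamma_is_nakagami (m r : ℝ) (hm : 0 < m) (hr : 0 < r) :
    Measure.map Real.sqrt (gammaMeasure m r) =
      volume.withDensity (fun x : ℝ => ENNReal.ofReal
        (if 0 < x then 2 * r ^ m / Real.Gamma m * x ^ (2 * m - 1) * Real.exp (-r * x ^ 2)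
         else 0)) := by
  ext s hs
  rw [Measure.map_apply Real.continuous_sqrt.measurable hs, gammaMeasure,
    withDensity_apply _ (Real.continuous_sqrt.measurable hs), withDensity_apply _ hs,
    ← setLIntegral_inter_Ioi_zero (fun x hx => gammaPDF_of_neg hx),
    ← setLIntegral_inter_Ioi_zero (fun x hx => by simp [hx.not_gt]) s,
    ← image_sq_inter_Ioi_zero,
    lintegral_image_eq_lintegral_abs_deriv_mul (f' := fun x => 2 * x)
      (hs.inter measurableSet_Ioi)
      (fun x _ => by simpa using (hasDerivAt_pow 2 x).hasDerivWithinAt)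
      (fun x hx y hy hxy => (sq_eq_sq₀ (le_of_lt hx.2) (le_of_lt hy.2)).1 hxy)]
  refine setLIntegral_congr_fun (hs.inter measurableSet_Ioi) fun x hx => ?_
  have hx0 : 0 < x := hx.2
  simp only [if_pos hx0]
  exact ofReal_abs_mul_gammaPDF_sq m r hx0
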